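/- arXiv:1305.4822 — 2 statements merged into one kernel-verified Lean document; each statement's English description precedes it below -/
import Mathlib

section
/- Let k ≥ 1, N ≥ 2k+1, and let λ_1, …, λ_k be real numbers with λ_i ≠ −1 for every i. If D is any diagonal N×N real matrix satisfying the intertwining relation Hᵀ · D = D · H (with H = H^{(N)}(λ_1,…,λ_k)) together with the normalization D_{k+1,k+1} = 1, then D = Θ^{(diag)}; i.e., the normalized diagonal Hermitizing metric is unique. -/
open Matrix BigOperators

noncomputable section

/-- `f(x) := (1-x)/(1+x)`. -/
def metricFactor (x : ℝ) : ℝ := (1 - x) / (1 + x)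

/-- The discrete square-well Hamiltonian `H^{(N)}(λ₁,…,λ_k)` (indices here are 0-based;
the 1-based row index of the paper is `i.val + 1`). -/
def Ham (N k : ℕ) (lam : ℕ → ℝ) : Matrix (Fin N) (Fin N) ℝ :=
  Matrix.of fun i j =>
    if i.val = j.val then 2
    else if j.val = i.val + 1 then
      (if i.val + 1 ≤ k then -1 - lam (i.val + 1)
       else if i.val + 1 < N - k then -1
       else -1 + lam (N - (i.val + 1)))
    else if i.val = j.val + 1 then
      (if j.val + 1 ≤ k then -1 + lam (j.val + 1)
       else if j.val + 1 < N - k then -1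
       else -1 - lam (N - (j.val + 1)))
    else 0

/-- The `j`-th (1-based) diagonal entry of the diagonal metric `Θ^{(diag)}`. -/
def thetaEntry (N k : ℕ) (lam : ℕ → ℝ) (j : ℕ) : ℝ :=
  if j ≤ k then ∏ i ∈ Finset.Icc j k, metricFactor (lam i)
  else if j ≤ N - k then 1
  else ∏ i ∈ Finset.Icc (N + 1 - j) k, metricFactor (lam i)

/-- The diagonal metric `Θ^{(diag)}`. -/
def ThetaDiag (N k : ℕ) (lam : ℕ → ℝ) : Matrix (Fin N) (Fin N) ℝ :=
  Matrix.diagonal fun i => thetaEntry N k lam (i.val + 1)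

lemma prod_metricFactor_Icc_eq_mul (lam : ℕ → ℝ) {j k : ℕ} (h : j ≤ k) :
    ∏ i ∈ Finset.Icc j k, metricFactor (lam i) =
      metricFactor (lam j) * ∏ i ∈ Finset.Icc (j + 1) k, metricFactor (lam i) := by
  rw [← Finset.insert_Icc_add_one_left_eq_Icc h, Finset.prod_insert (by simp)]

lemma thetaEntry_of_le {N k : ℕ} (hN : 2 * k + 1 ≤ N) (lam : ℕ → ℝ) {j : ℕ} (h : j ≤ k + 1) :
    thetaEntry N k lam j = ∏ i ∈ Finset.Icc j k, metricFactor (lam i) := by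
  rcases h.lt_or_eq with h | rfl
  · simp [thetaEntry, Nat.lt_succ_iff.mp h]
  · have : k + 1 ≤ N - k := by omega
    simp [thetaEntry, this]

lemma thetaEntry_of_mem {N k : ℕ} (lam : ℕ → ℝ) {j : ℕ} (h : k < j) (h' : j ≤ N - k) :
    thetaEntry N k lam j = 1 := by
  simp [thetaEntry, h.not_ge, h']

lemma thetaEntry_of_ge {N k : ℕ} (hN : 2 * k + 1 ≤ N) (lam : ℕ → ℝ) {j : ℕ} (h : N - k ≤ j) :
    thetaEntry N k lam j = ∏ i ∈ Finset.Icc (N + 1 - j) k, metricFactor (lam i) := by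
  have hj : ¬ j ≤ k := by omega
  rcases h.eq_or_lt with h | h
  · have : k < N + 1 - j := by omega
    simp [thetaEntry, hj, h, Finset.Icc_eq_empty_of_lt this]
  · simp [thetaEntry, hj, h.not_ge]

/-- The intertwining relation, read off on the entry coupling two neighbouring sites. -/
lemma Ham_intertwining_entry {N k : ℕ} {lam : ℕ → ℝ} {d : Fin N → ℝ}
    (hint : (Ham N k lam)ᵀ * Matrix.diagonal d = Matrix.diagonal d * Ham N k lam)
    (i j : Fin N) : Ham N k lam j i * d j = d i * Ham N k lam i j := by
  simpa [Matrix.mul_diagonal, Matrix.diagonal_mul] using congrFun (congrFun hint i) j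

lemma metric_step_left {N k : ℕ} {lam : ℕ → ℝ}
    (hlam : ∀ i, 1 ≤ i → i ≤ k → lam i ≠ -1) {d : Fin N → ℝ}
    (hint : (Ham N k lam)ᵀ * Matrix.diagonal d = Matrix.diagonal d * Ham N k lam)
    {n : ℕ} (hn : n + 1 < N) (hnk : n + 1 ≤ k) :
    d ⟨n, by omega⟩ = metricFactor (lam (n + 1)) * d ⟨n + 1, hn⟩ := by
  have h := Ham_intertwining_entry hint ⟨n, by omega⟩ ⟨n + 1, hn⟩
  have hlt : n < k := hnk
  have hne' : n ≠ n + 1 + 1 := by omega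
  simp [Ham, hlt, hne'] at h
  have hne : 1 + lam (n + 1) ≠ 0 := fun h0 =>
    hlam (n + 1) (by omega) hnk (by linarith)
  rw [metricFactor, div_mul_eq_mul_div, eq_div_iff hne]
  linarith

lemma metric_step_middle {N k : ℕ} {lam : ℕ → ℝ} {d : Fin N → ℝ}
    (hint : (Ham N k lam)ᵀ * Matrix.diagonal d = Matrix.diagonal d * Ham N k lam)
    {n : ℕ} (hn : n + 1 < N) (hkn : k ≤ n) (hnk : n + 1 < N - k) :
    d ⟨n + 1, hn⟩ = d ⟨n, by omega⟩ := by
  have h := Ham_intertwining_entry hint ⟨n, by omega⟩ ⟨n + 1, hn⟩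
  have hne' : n ≠ n + 1 + 1 := by omega
  simpa [Ham, hkn.not_gt, hnk, hne'] using h

lemma metric_step_right {N k : ℕ} {lam : ℕ → ℝ}
    (hlam : ∀ i, 1 ≤ i → i ≤ k → lam i ≠ -1) {d : Fin N → ℝ}
    (hint : (Ham N k lam)ᵀ * Matrix.diagonal d = Matrix.diagonal d * Ham N k lam)
    {n : ℕ} (hn : n + 1 < N) (hkn : k ≤ n) (hnk : N - k ≤ n + 1) :
    d ⟨n + 1, hn⟩ = metricFactor (lam (N - (n + 1))) * d ⟨n, by omega⟩ := by
  have h := Ham_intertwining_entry hint ⟨n, by omega⟩ ⟨n + 1, hn⟩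
  have hne' : n ≠ n + 1 + 1 := by omega
  simp [Ham, hkn.not_gt, hnk.not_gt, hne'] at h
  have hne : 1 + lam (N - (n + 1)) ≠ 0 := fun h0 =>
    hlam (N - (n + 1)) (by omega) (by omega) (by linarith)
  rw [metricFactor, div_mul_eq_mul_div, eq_div_iff hne]
  linarith

/-- for `k ≥ 1`, `N ≥ 2k+1`, `λᵢ ≠ -1`, any diagonal real matrix `D`
satisfying `Hᵀ ⬝ D = D ⬝ H` and normalized by `D_{k+1,k+1} = 1` (1-based indexing,
i.e. 0-based index `k`) coincides with `Θ^{(diag)}`: the normalized diagonal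
Hermitizing metric is unique. -/
theorem diag_metric_unique (k N : ℕ) (hk : 1 ≤ k) (hN : 2 * k + 1 ≤ N)
    (lam : ℕ → ℝ) (hlam : ∀ i, 1 ≤ i → i ≤ k → lam i ≠ -1)
    (d : Fin N → ℝ)
    (hint : (Ham N k lam)ᵀ * Matrix.diagonal d = Matrix.diagonal d * Ham N k lam)
    (hnorm : d ⟨k, by omega⟩ = 1) :
    Matrix.diagonal d = ThetaDiag N k lam := by
  have left : ∀ n (hn : n ≤ k), d ⟨n, by omega⟩ = thetaEntry N k lam (n + 1) := by
    intro n hn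
    induction hn using Nat.decreasingInduction with
    | self => rw [hnorm, thetaEntry_of_mem lam (by omega) (by omega)]
    | of_succ n hn ih =>
      rw [metric_step_left hlam hint (by omega) hn, ih, thetaEntry_of_le hN lam (by omega),
        thetaEntry_of_le hN lam (by omega), ← prod_metricFactor_Icc_eq_mul lam hn]
  have right : ∀ n, k ≤ n → ∀ hn : n < N, d ⟨n, hn⟩ = thetaEntry N k lam (n + 1) := by
    intro n hkn
    induction n, hkn using Nat.le_induction with
    | base => exact fun _ => left k le_rfl
    | succ n hkn ih =>
      intro hn
      rcases lt_or_ge (n + 1) (N - k) with h | h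
      · rw [metric_step_middle hint hn hkn h, ih, thetaEntry_of_mem lam (by omega) (by omega),
          thetaEntry_of_mem lam (by omega) (by omega)]
      · rw [metric_step_right hlam hint hn hkn h, ih, thetaEntry_of_ge hN lam h,
          thetaEntry_of_ge hN lam (by omega), Nat.add_sub_add_right N 1 (n + 1),
          prod_metricFactor_Icc_eq_mul lam (by omega : N - (n + 1) ≤ k),
          show N + 1 - (n + 1) = N - (n + 1) + 1 by omega]
  refine congrArg Matrix.diagonal (funext fun i => ?_)
  rcases le_total i.val k with h | h
  · exact left i h
  · exact right i h i.isLt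
end
end

section
/- For t = 1 and for t = −1, the secular polynomial of H^{(11)}(9/10,−t,t,−t), i.e. the characteristic polynomial det(E·I − (H − 2I)) of the shifted matrix H − 2I, equals E^{11} − (119/50)E⁹ + (7961/10000)E⁷ − (361/5000)E⁵. -/
open Matrix Polynomial

noncomputable section

/-- The 11×11 Hamiltonian; `H^{(11)}(9/10,−t,t,−t)` of the paper is `H11 (9/10) t t t`
below (0-based indices): all diagonal entries `2`, superdiagonal entries (row order)
`−1−9/10, −1+t, −1−t, −1+t, −1, −1, −1−t, −1+t, −1−t, −1+9/10`, subdiagonal entries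
`−1+9/10, −1−t, −1+t, −1−t, −1, −1, −1+t, −1−t, −1+t, −1−9/10`, zero elsewhere. -/
def H11 (l m n r : ℝ) : Matrix (Fin 11) (Fin 11) ℝ :=
  Matrix.of fun i j =>
    if i = j then 2
    else if h : j.val = i.val + 1 then
      ![-1-l, -1+m, -1-n, -1+r, -1, -1, -1-r, -1+n, -1-m, -1+l]
        ⟨i.val, by have := j.isLt; omega⟩
    else if h' : i.val = j.val + 1 then
      ![-1+l, -1-m, -1+n, -1-r, -1, -1, -1+r, -1-n, -1+m, -1-l]
        ⟨j.val, by have := i.isLt; omega⟩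
    else 0

/-- The tridiagonal matrix with diagonal `a`, superdiagonal `b` and subdiagonal `c`. -/
def tridiagonal {R : Type*} [Zero R] (n : ℕ) (a b c : ℕ → R) : Matrix (Fin n) (Fin n) R :=
  Matrix.of fun i j =>
    if i.val = j.val then a i
    else if j.val = i.val + 1 then b i
    else if i.val = j.val + 1 then c j
    else 0

/-- The three-term recurrence for continuants. -/
theorem det_tridiagonal_succ_succ {R : Type*} [CommRing R] (n : ℕ) (a b c : ℕ → R) :
    (tridiagonal (n + 2) a b c).det =
      a 0 * (tridiagonal (n + 1) (fun k => a (k + 1)) (fun k => b (k + 1))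
          (fun k => c (k + 1))).det
        - b 0 * c 0 * (tridiagonal n (fun k => a (k + 2)) (fun k => b (k + 2))
          (fun k => c (k + 2))).det := by
  have minor_zero : (tridiagonal (n + 2) a b c).submatrix Fin.succ (Fin.succAbove 0) =
      tridiagonal (n + 1) (fun k => a (k + 1)) (fun k => b (k + 1)) (fun k => c (k + 1)) := by
    ext i j
    simp [tridiagonal]
  have minor_one : ((tridiagonal (n + 2) a b c).submatrix Fin.succ (Fin.succAbove 1)).det =
      c 0 * (tridiagonal n (fun k => a (k + 2)) (fun k => b (k + 2)) (fun k => c (k + 2))).det := by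
    rw [det_succ_column_zero, Fin.sum_univ_succ, Finset.sum_eq_zero]
    · have : ((tridiagonal (n + 2) a b c).submatrix Fin.succ (Fin.succAbove 1)).submatrix
          (Fin.succAbove 0) Fin.succ =
          tridiagonal n (fun k => a (k + 2)) (fun k => b (k + 2)) (fun k => c (k + 2)) := by
        ext i j
        have h : (1 : Fin (n + 2)).succAbove j.succ = j.succ.succ :=
          Fin.succAbove_of_le_castSucc _ _ (by simp [Fin.le_def])
        simp [tridiagonal, h]
      rw [this]
      simp [tridiagonal]
    · intro i _
      simp [tridiagonal]
  rw [det_succ_row_zero, Fin.sum_univ_succ, Fin.sum_univ_succ, Finset.sum_eq_zero]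
  · rw [minor_zero, Fin.succ_zero_eq_one, minor_one]
    simp [tridiagonal]
    ring
  · intro j _
    simp [tridiagonal]

theorem det_tridiagonal_eleven {R : Type*} [CommRing R] (x : R) (b c : ℕ → R)
    (h1 : b 1 * c 1 = 0) (h2 : b 2 * c 2 = 0) (h3 : b 3 * c 3 = 0)
    (h6 : b 6 * c 6 = 0) (h7 : b 7 * c 7 = 0) (h8 : b 8 * c 8 = 0) :
    (tridiagonal 11 (fun _ => x) b c).det =
      x ^ 5 * (x ^ 2 - b 0 * c 0) * (x ^ 2 - b 4 * c 4 - b 5 * c 5) * (x ^ 2 - b 9 * c 9) := by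
  have det_zero (a b c : ℕ → R) : (tridiagonal 0 a b c).det = 1 := det_isEmpty
  have det_one (a b c : ℕ → R) : (tridiagonal 1 a b c).det = a 0 := by
    simp [tridiagonal]
  simp only [det_tridiagonal_succ_succ, det_zero, det_one, Nat.reduceAdd, zero_add, h1, h2, h3, h6,
    h7, h8, zero_mul, sub_zero, mul_one]
  ring

theorem charmatrix_H11_sub_two (l m n r : ℝ) :
    (H11 l m n r - 2).charmatrix =
      tridiagonal 11 (fun _ => X)
        (fun k => if h : k < 10 then
          C (-(![-1-l, -1+m, -1-n, -1+r, -1, -1, -1-r, -1+n, -1-m, -1+l] ⟨k, h⟩)) else 0)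
        (fun k => if h : k < 10 then
          C (-(![-1+l, -1-m, -1+n, -1-r, -1, -1, -1+r, -1-n, -1+m, -1-l] ⟨k, h⟩)) else 0) := by
  ext1 i j
  have two_apply : (2 : Matrix (Fin 11) (Fin 11) ℝ) i j = if i = j then 2 else 0 := by
    rw [← Matrix.diagonal_ofNat, Matrix.diagonal_apply]
  rw [charmatrix_apply, Matrix.sub_apply, two_apply, Matrix.diagonal_apply]
  have hi := i.isLt
  have hj := j.isLt
  simp only [H11, tridiagonal, Matrix.of_apply, ← Fin.ext_iff]
  by_cases hij : i = j
  · simp [hij]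
  · by_cases hsup : j.val = i.val + 1
    · have : i.val < 10 := by omega
      simp only [hij, hsup, this, if_false, if_true, dite_true, sub_zero, zero_sub, C_neg]
    · by_cases hsub : i.val = j.val + 1
      · have : j.val < 10 := by omega
        have hne : ¬ j.val = j.val + 1 + 1 := by omega
        simp only [hij, hne, hsub, this, if_false, if_true, dite_true, dite_false, sub_zero,
          zero_sub, C_neg]
      · simp [hij, hsup, hsub]

/-- for `t = 1` and for `t = −1`, the secular polynomial of
`H^{(11)}(9/10,−t,t,−t)`, i.e. the characteristic polynomial `det(E·I − (H − 2I))`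
of the shifted matrix `H − 2I`, equals
`E^11 − (119/50)E⁹ + (7961/10000)E⁷ − (361/5000)E⁵`. -/
theorem secular_polynomial_fixed_lambda (t : ℝ) (ht : t = 1 ∨ t = -1) :
    (H11 (9 / 10) t t t - 2).charpoly =
      X ^ 11 - C ((119 : ℝ) / 50) * X ^ 9 + C ((7961 : ℝ) / 10000) * X ^ 7
        - C ((361 : ℝ) / 5000) * X ^ 5 := by
  have hC (u v : ℝ) (h : u * v = 0) : C (-u) * C (-v) = (0 : ℝ[X]) := by
    rw [← C_mul, neg_mul_neg, h, C_0]
  have h₁ : (-1 + t) * (-1 - t) = 0 := by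
    rcases ht with rfl | rfl <;> norm_num
  have h₂ : (-1 - t) * (-1 + t) = 0 := by
    rw [mul_comm, h₁]
  rw [Matrix.charpoly, charmatrix_H11_sub_two, det_tridiagonal_eleven]
  rotate_left
  · exact hC _ _ h₁
  · exact hC _ _ h₂
  · exact hC _ _ h₁
  · exact hC _ _ h₂
  · exact hC _ _ h₁
  · exact hC _ _ h₂
  change X ^ 5 * (X ^ 2 - C (-(-1 - 9 / 10)) * C (-(-1 + 9 / 10))) *
    (X ^ 2 - C (-(-1)) * C (-(-1)) - C (-(-1)) * C (-(-1))) *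
    (X ^ 2 - C (-(-1 + 9 / 10)) * C (-(-1 - 9 / 10))) = _
  have e₁ : (119 : ℝ) / 50 = 2 + 2 * (19 / 100) := by norm_num
  have e₂ : (7961 : ℝ) / 10000 = 4 * (19 / 100) + (19 / 100) * (19 / 100) := by norm_num
  have e₃ : (361 : ℝ) / 5000 = 2 * ((19 / 100) * (19 / 100)) := by norm_num
  have e₄ : -(-1 - (9 : ℝ) / 10) * -(-1 + 9 / 10) = 19 / 100 := by norm_num
  have e₅ : -(-1 + (9 : ℝ) / 10) * -(-1 - 9 / 10) = 19 / 100 := by norm_num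
  simp only [← C_mul, e₁, e₂, e₃, e₄, e₅]
  generalize (19 : ℝ) / 100 = p
  simp only [C_add, C_mul, C_neg, C_1, C_ofNat]
  ring
end
end
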